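/- For every integer r > 0 there exists a constant C = C(r) > 0 (depending only on r, not on the number of vertices) such that the following holds. Let G = (V,E) be a graph on n vertices (identify V with {1,…,n}) admitting a tree decomposition of width at most r, let cap : E → ℝ≥0 be edge capacities, let D be a set of unordered demand pairs with demands dem : D → ℝ≥0, and let y = (y_I) be any vector in SA_{r+3}(n) satisfying y_{I,J} = y_{J,I} for all I,J with |I ∪ J| ≤ r+3 and the normalization Σ_{(i,j)∈D} dem(i,j)·y_{i≠j} = 1. Then there exists S ⊆ V such that Σ_{(u,v)∈(S,S̄)∩D} dem(u,v) > 0 and Φ(S) ≤ C · Σ_{(i,j)∈E} cap(i,j)·y_{i≠j}. In particular, the minimum sparsity of a cut of G is at most C times the optimal value of this linear-programming relaxation. -/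

import Mathlib

open Finset

/-- `y_{I,J} = ∑_{I' ⊆ I} (-1)^{|I'|} y_{I' ∪ J}`. -/
def saIJ {n : ℕ} (y : Finset (Fin n) → ℝ) (I J : Finset (Fin n)) : ℝ :=
  ∑ I' ∈ I.powerset, (-1 : ℝ) ^ I'.card * y (I' ∪ J)

/-- Membership in the Sherali–Adams polytope `SA_t(n)`. -/
def memSA {n : ℕ} (t : ℕ) (y : Finset (Fin n) → ℝ) : Prop :=
  ∀ I J : Finset (Fin n), (I ∪ J).card ≤ t → 0 ≤ saIJ y I J

/-- `y_{i≠j} = y_{{i},{j}} + y_{{j},{i}}`. -/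
def yNeq {n : ℕ} (y : Finset (Fin n) → ℝ) (i j : Fin n) : ℝ :=
  saIJ y {i} {j} + saIJ y {j} {i}

/-- A tree decomposition of a graph `G`: a family of bags indexed by the nodes of a tree
(a connected acyclic graph), covering all vertices and edges, such that for each vertex the
bags containing it induce a connected subtree. -/
structure TreeDecomp {V : Type} (G : SimpleGraph V) where
  ι : Type
  fintype_ι : Fintype ι
  T : SimpleGraph ι
  connected : T.Connected
  acyclic : T.IsAcyclic
  bags : ι → Finset V
  covers_vertices : ∀ v : V, ∃ i, v ∈ bags i
  covers_edges : ∀ u v : V, G.Adj u v → ∃ i, u ∈ bags i ∧ v ∈ bags i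
  bags_connected : ∀ v : V, (T.induce {i | v ∈ bags i}).Connected


open scoped Classical in
/-- The total `f`-mass of the points of layer `k` whose potential lies in `S`. -/
noncomputable def levelMass {α : Type*} [Fintype α] (f A : ℕ → α → ℝ) (k : ℕ) (S : Set ℝ) : ℝ :=
  ∑ x, if A k x ∈ S then f k x else 0

/-- The second moment of the potential on layer `k`. -/
noncomputable def layerEnergy {α : Type*} [Fintype α] (m A : ℕ → α → ℝ) (k : ℕ) : ℝ :=
  ∑ x, m k x * A k x ^ 2

/-- A layered network with edge weights `w` and layer masses `m`, a flow `F ≤ w` with layer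
values `f`, and a potential `A` which is a reverse martingale with respect to `w`. -/
structure LayeredFlow {α : Type*} [Fintype α] (w F : ℕ → α → α → ℝ) (m f A : ℕ → α → ℝ) :
    Prop where
  flow_nonneg : ∀ k x x', 0 ≤ F k x x'
  flow_le : ∀ k x x', F k x x' ≤ w k x x'
  sum_weight_right : ∀ k x, ∑ x', w k x x' = m k x
  sum_weight_left : ∀ k x', ∑ x, w k x x' = m (k + 1) x'
  sum_flow_right : ∀ k x, ∑ x', F k x x' = f k x
  sum_flow_left : ∀ k x', ∑ x, F k x x' = f (k + 1) x'
  martingale : ∀ k x', ∑ x, w k x x' * A k x = m (k + 1) x' * A (k + 1) x'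

/-- The constant in the flow bound for potentials with at most `K` intermediate values. -/
noncomputable def flowConst : ℕ → ℝ
  | 0 => 1
  | K + 1 => 16 * (flowConst K + 1)

theorem flowConst_pos (K : ℕ) : 0 < flowConst K := by
  induction K with
  | zero => simp [flowConst]
  | succ K ih => simp only [flowConst]; positivity

namespace LayeredFlow

variable {α : Type*} [Fintype α] {w F : ℕ → α → α → ℝ} {m f A : ℕ → α → ℝ}

theorem weight_nonneg (L : LayeredFlow w F m f A) (k : ℕ) (x x' : α) : 0 ≤ w k x x' :=
  (L.flow_nonneg k x x').trans (L.flow_le k x x')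

theorem f_nonneg (L : LayeredFlow w F m f A) (k : ℕ) (x : α) : 0 ≤ f k x := by
  rw [← L.sum_flow_right]
  exact Finset.sum_nonneg fun x' _ => L.flow_nonneg k x x'

theorem f_le (L : LayeredFlow w F m f A) (k : ℕ) (x : α) : f k x ≤ m k x := by
  rw [← L.sum_flow_right, ← L.sum_weight_right]
  exact Finset.sum_le_sum fun x' _ => L.flow_le k x x'

theorem m_nonneg (L : LayeredFlow w F m f A) (k : ℕ) (x : α) : 0 ≤ m k x :=
  (L.f_nonneg k x).trans (L.f_le k x)

theorem sum_mul_eq_left (L : LayeredFlow w F m f A) (k : ℕ) (φ : α → ℝ) :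
    ∑ x, ∑ x', w k x x' * φ x = ∑ x, m k x * φ x := by
  simp_rw [← Finset.sum_mul, L.sum_weight_right]

theorem sum_mul_eq_right (L : LayeredFlow w F m f A) (k : ℕ) (φ : α → ℝ) :
    ∑ x, ∑ x', w k x x' * φ x' = ∑ x, m (k + 1) x * φ x := by
  rw [Finset.sum_comm]
  simp_rw [← Finset.sum_mul, L.sum_weight_left]

theorem sum_weight_mul_sq (L : LayeredFlow w F m f A) (k : ℕ) :
    ∑ x, ∑ x', w k x x' * (A k x - A (k + 1) x') ^ 2 =
      layerEnergy m A k - layerEnergy m A (k + 1) := by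
  have h1 := L.sum_mul_eq_left k fun x => A k x ^ 2
  have h2 := L.sum_mul_eq_right k fun x => A (k + 1) x ^ 2
  have h3 : ∑ x, ∑ x', w k x x' * (A k x * A (k + 1) x') = layerEnergy m A (k + 1) := by
    rw [Finset.sum_comm, layerEnergy]
    refine Finset.sum_congr rfl fun x' _ => ?_
    rw [sq, ← mul_assoc, ← L.martingale, Finset.sum_mul]
    exact Finset.sum_congr rfl fun x _ => by ring
  have h4 : ∑ x, ∑ x', w k x x' * (A k x - A (k + 1) x') ^ 2 =
      ∑ x, ∑ x', w k x x' * A k x ^ 2 + ∑ x, ∑ x', w k x x' * A (k + 1) x' ^ 2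
        - 2 * ∑ x, ∑ x', w k x x' * (A k x * A (k + 1) x') := by
    simp_rw [Finset.mul_sum, ← Finset.sum_add_distrib, ← Finset.sum_sub_distrib]
    exact Finset.sum_congr rfl fun x _ => Finset.sum_congr rfl fun x' _ => by ring
  rw [h4, h1, h2, h3]
  simp only [layerEnergy]
  ring

theorem layerEnergy_anti (L : LayeredFlow w F m f A) : Antitone (layerEnergy m A) := by
  refine antitone_nat_of_succ_le fun k => ?_
  have := L.sum_weight_mul_sq k
  have h : 0 ≤ ∑ x, ∑ x', w k x x' * (A k x - A (k + 1) x') ^ 2 :=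
    Finset.sum_nonneg fun x _ => Finset.sum_nonneg fun x' _ =>
      mul_nonneg (L.weight_nonneg k x x') (sq_nonneg _)
  linarith

theorem levelMass_mono (L : LayeredFlow w F m f A) {k : ℕ} {S S' : Set ℝ}
    (h : ∀ x, A k x ∈ S → A k x ∈ S') : levelMass f A k S ≤ levelMass f A k S' := by
  classical
  refine Finset.sum_le_sum fun x _ => ?_
  have := h x
  have := L.f_nonneg k x
  split_ifs <;> tauto

theorem levelMass_le_succ (L : LayeredFlow w F m f A) {k : ℕ} {S S' : Set ℝ} {d : ℝ} (hd : 0 < d)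
    (h : ∀ x x', A k x ∈ S → A (k + 1) x' ∉ S' → d ≤ A k x - A (k + 1) x') :
    levelMass f A k S ≤ levelMass f A (k + 1) S' +
      (layerEnergy m A k - layerEnergy m A (k + 1)) / d ^ 2 := by
  classical
  have h1 : levelMass f A k S = ∑ x, ∑ x', if A k x ∈ S then F k x x' else 0 := by
    refine Finset.sum_congr rfl fun x _ => ?_
    split_ifs <;> simp [L.sum_flow_right]
  have h2 : levelMass f A (k + 1) S' = ∑ x, ∑ x', if A (k + 1) x' ∈ S' then F k x x' else 0 := by
    rw [Finset.sum_comm]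
    refine Finset.sum_congr rfl fun x _ => ?_
    split_ifs <;> simp [L.sum_flow_left]
  rw [h1, h2, ← L.sum_weight_mul_sq k, Finset.sum_div, ← Finset.sum_add_distrib]
  refine Finset.sum_le_sum fun x _ => ?_
  rw [Finset.sum_div, ← Finset.sum_add_distrib]
  refine Finset.sum_le_sum fun x' _ => ?_
  have hF := L.flow_nonneg k x x'
  have hw := L.flow_le k x x'
  have hw0 := L.weight_nonneg k x x'
  have h0 : 0 ≤ w k x x' * (A k x - A (k + 1) x') ^ 2 / d ^ 2 := by positivity
  by_cases hS : A k x ∈ S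
  · by_cases hS' : A (k + 1) x' ∈ S'
    · simp only [hS, hS', if_true]; linarith
    · simp only [hS, hS', if_true, if_false]
      have hd' := h x x' hS hS'
      rw [zero_add, le_div_iff₀ (by positivity)]
      have : d ^ 2 ≤ (A k x - A (k + 1) x') ^ 2 := by gcongr
      exact mul_le_mul hw this (by positivity) hw0
  · simp only [hS, if_false]
    split_ifs <;> linarith

/-- Jensen's inequality along the reverse martingale, for the positive part of the quadratic
`(t - p) * (t - q)`. -/
theorem sum_mul_posPart_anti (L : LayeredFlow w F m f A) (p q : ℝ) :
    Antitone fun k => ∑ x, m k x * max ((A k x - p) * (A k x - q)) 0 := by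
  refine antitone_nat_of_succ_le fun k => ?_
  rw [← L.sum_mul_eq_left k, Finset.sum_comm]
  refine Finset.sum_le_sum fun x' _ => ?_
  rcases le_total ((A (k + 1) x' - p) * (A (k + 1) x' - q)) 0 with h | h
  · rw [max_eq_right h, mul_zero]
    exact Finset.sum_nonneg fun x _ => mul_nonneg (L.weight_nonneg k x x') (le_max_right _ _)
  · rw [max_eq_left h]
    have key : m (k + 1) x' * ((A (k + 1) x' - p) * (A (k + 1) x' - q)) =
        ∑ x, w k x x' * ((A (k + 1) x' - p) * (A (k + 1) x' - q) +
          (2 * A (k + 1) x' - p - q) * (A k x - A (k + 1) x')) := by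
      have h1 := L.martingale k x'
      have h2 := L.sum_weight_left k x'
      simp_rw [mul_add, Finset.sum_add_distrib, ← Finset.sum_mul, h2]
      have : ∑ x, w k x x' * ((2 * A (k + 1) x' - p - q) * (A k x - A (k + 1) x')) =
          (2 * A (k + 1) x' - p - q) *
            (∑ x, w k x x' * A k x - (∑ x, w k x x') * A (k + 1) x') := by
        rw [Finset.sum_mul, ← Finset.sum_sub_distrib, Finset.mul_sum]
        exact Finset.sum_congr rfl fun x _ => by ring
      rw [this, h1, h2]
      ring
    rw [key]
    refine Finset.sum_le_sum fun x _ => mul_le_mul_of_nonneg_left ?_ (L.weight_nonneg k x x')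
    refine le_trans ?_ (le_max_left _ _)
    nlinarith [sq_nonneg (A k x - A (k + 1) x')]

theorem sum_m_eq (L : LayeredFlow w F m f A) (i j : ℕ) : ∑ x, m i x = ∑ x, m j x := by
  have h : ∀ k, ∑ x, m k x = ∑ x, m 0 x := by
    intro k
    induction k with
    | zero => rfl
    | succ k ih =>
      rw [← ih]
      simp_rw [← L.sum_weight_left, ← L.sum_weight_right]
      exact Finset.sum_comm
  rw [h i, h j]

theorem sum_m_mul_eq (L : LayeredFlow w F m f A) (i j : ℕ) :
    ∑ x, m i x * A i x = ∑ x, m j x * A j x := by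
  have h : ∀ k, ∑ x, m k x * A k x = ∑ x, m 0 x * A 0 x := by
    intro k
    induction k with
    | zero => rfl
    | succ k ih =>
      rw [← ih, ← L.sum_mul_eq_left k (A k), Finset.sum_comm]
      exact Finset.sum_congr rfl fun x' _ => (L.martingale k x').symm
  rw [h i, h j]

/-- If layer `i` avoids the potential gap `(p, q)`, then mass of a later layer deep inside
the gap is paid for by the energy drop. -/
theorem sq_mul_levelMass_le (L : LayeredFlow w F m f A) {i j : ℕ} (hij : i ≤ j) {p q h : ℝ}
    (hpq : p ≤ q) (hh : 0 < h) (hi : ∀ x, A i x ≤ p ∨ q ≤ A i x) :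
    levelMass m A j (Set.Icc (p + h) (q - h)) ≤
      (layerEnergy m A i - layerEnergy m A j) / h ^ 2 := by
  classical
  have hQ : ∀ k, ∑ x, m k x * ((A k x - p) * (A k x - q)) =
      layerEnergy m A k - (p + q) * ∑ x, m k x * A k x + p * q * ∑ x, m k x := by
    intro k
    rw [layerEnergy, Finset.mul_sum, Finset.mul_sum, ← Finset.sum_sub_distrib,
      ← Finset.sum_add_distrib]
    exact Finset.sum_congr rfl fun x _ => by ring
  have h1 : ∑ x, m i x * max ((A i x - p) * (A i x - q)) 0 =
      ∑ x, m i x * ((A i x - p) * (A i x - q)) := by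
    refine Finset.sum_congr rfl fun x _ => ?_
    rw [max_eq_left]
    rcases hi x with hx | hx
    · exact mul_nonneg_of_nonpos_of_nonpos (by linarith) (by linarith)
    · exact mul_nonneg (by linarith) (by linarith)
  have h2 := L.sum_mul_posPart_anti p q hij
  have h3 : h ^ 2 * levelMass m A j (Set.Icc (p + h) (q - h)) ≤
      ∑ x, m j x * max ((A j x - p) * (A j x - q)) 0 -
        ∑ x, m j x * ((A j x - p) * (A j x - q)) := by
    rw [levelMass, Finset.mul_sum, ← Finset.sum_sub_distrib]
    refine Finset.sum_le_sum fun x _ => ?_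
    have hm := L.m_nonneg j x
    rw [← mul_sub]
    split_ifs with hx
    · rw [mul_comm]
      refine mul_le_mul_of_nonneg_left ?_ hm
      have h4 := le_max_right ((A j x - p) * (A j x - q)) 0
      have h5 : 0 ≤ (A j x - p - h) * (q - A j x) :=
        mul_nonneg (by linarith [hx.1]) (by linarith [hx.2])
      nlinarith [hx.1, hx.2]
    · rw [mul_zero]
      exact mul_nonneg hm (by linarith [le_max_left ((A j x - p) * (A j x - q)) 0])
  rw [le_div_iff₀ (by positivity), mul_comm]
  simp only at h2
  rw [h1, hQ i] at h2
  rw [hQ j, ← L.sum_m_eq i j, ← L.sum_m_mul_eq i j] at h3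
  linarith

/-- A reverse martingale potential taking few values strictly between `a` and `b` on each layer
lets only little flow pass from potential `≥ b` to potential `≤ a`. -/
theorem levelMass_le (L : LayeredFlow w F m f A) (K : ℕ) : ∀ {i j : ℕ} {a b : ℝ}, i ≤ j → a < b →
    (∀ l, i < l → l < j → {x | A l x ∈ Set.Ioo a b}.ncard ≤ K) →
    levelMass f A i (Set.Ici b) ≤ levelMass f A j (Set.Ioi a) +
      flowConst K * (layerEnergy m A i - layerEnergy m A j) / (b - a) ^ 2 := by
  classical
  induction K with
  | zero =>
    intro i j a b hij hab hcard
    have hempty : ∀ l, i < l → l < j → ∀ x, A l x ≤ a ∨ b ≤ A l x := by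
      intro l hil hlj x
      have := hcard l hil hlj
      rw [Nat.le_zero, Set.ncard_eq_zero (Set.toFinite _)] at this
      by_contra! hx
      exact Set.eq_empty_iff_forall_notMem.1 this x hx
    have hd : 0 < b - a := sub_pos.2 hab
    simp only [flowConst, one_mul]
    rcases hij.eq_or_lt with rfl | hlt
    · simp only [sub_self, zero_div, add_zero]
      exact L.levelMass_mono fun x hx => lt_of_lt_of_le hab hx
    have hstep : ∀ l, i ≤ l → l < j → levelMass f A i (Set.Ici b) ≤
        levelMass f A l (Set.Ici b) + (layerEnergy m A i - layerEnergy m A l) / (b - a) ^ 2 := by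
      intro l hil
      induction l, hil using Nat.le_induction with
      | base => simp
      | succ l hil ih =>
        intro hlj
        have h1 := ih (by omega)
        have h2 := L.levelMass_le_succ (k := l) (S := Set.Ici b) (S' := Set.Ici b) hd (by
          intro x x' hx hx'
          rcases hempty (l + 1) (by omega) hlj x' with h | h
          · have : b ≤ A l x := hx
            linarith
          · exact absurd h hx')
        rw [sub_div] at *
        linarith
    obtain ⟨l, rfl⟩ : ∃ l, j = l + 1 := ⟨j - 1, by omega⟩
    have h1 := hstep l (by omega) (by omega)
    have h2 := L.levelMass_le_succ (k := l) (S := Set.Ici b) (S' := Set.Ioi a) hd (by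
      intro x x' hx hx'
      have h3 : b ≤ A l x := hx
      have h4 : A (l + 1) x' ≤ a := not_lt.1 hx'
      linarith)
    rw [sub_div] at *
    linarith
  | succ K ih =>
    intro i j a b hij hab hcard
    rcases hij.eq_or_lt with rfl | hlt
    · simp only [sub_self, mul_zero, zero_div, add_zero]
      exact L.levelMass_mono fun x hx => lt_of_lt_of_le hab hx
    obtain ⟨h, hh, rfl⟩ : ∃ h, 0 < h ∧ b = a + 4 * h := ⟨(b - a) / 4, by linarith, by ring⟩
    set T : ℕ → Prop := fun l => ∀ x, A l x ∈ Set.Ioo a (a + 4 * h) →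
      A l x ∈ Set.Ioo (a + 3 * h) (a + 4 * h) with hT
    set M : ℕ → Prop := fun l => ∀ x, A l x ∈ Set.Ioo a (a + 4 * h) →
      A l x ∈ Set.Ioo (a + h) (a + 2 * h) with hM
    have hsub : ∀ l, i < l → l < j → ∀ p q, a ≤ p → q ≤ a + 4 * h →
        (¬ ∀ x, A l x ∈ Set.Ioo a (a + 4 * h) → A l x ∈ Set.Ioo p q) →
        {x | A l x ∈ Set.Ioo p q}.ncard ≤ K := by
      intro l hil hlj p q hp hq hn
      push Not at hn
      obtain ⟨x, hx, hx'⟩ := hn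
      have hss : {x | A l x ∈ Set.Ioo p q} ⊂ {x | A l x ∈ Set.Ioo a (a + 4 * h)} := by
        refine ⟨fun z hz => ⟨lt_of_le_of_lt hp hz.1, lt_of_lt_of_le hz.2 hq⟩, fun hs => ?_⟩
        exact hx' (hs hx)
      have := Set.ncard_lt_ncard hss (Set.toFinite _)
      have := hcard l hil hlj
      omega
    set c := flowConst K with hc
    have hc0 : 0 < c := flowConst_pos K
    have hX : ∀ l' l, i ≤ l' → l' < l → l ≤ j → (∀ k, l' < k → k < l → ¬ T k ∧ ¬ M k) →
        levelMass f A l' (Set.Ici (a + 2 * h)) ≤ levelMass f A l (Set.Ioi (a + h)) +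
          c * (layerEnergy m A l' - layerEnergy m A l) / h ^ 2 := by
      intro l' l h1 h2 h3 hgood
      have := ih (i := l') (j := l) (a := a + h) (b := a + 2 * h) h2.le (by linarith)
        fun k hk hk' => hsub k (by omega) (by omega) _ _ (by linarith) (by linarith)
          (hgood k hk hk').2
      rwa [show a + 2 * h - (a + h) = h by ring] at this
    have hY : ∀ l' l, i ≤ l' → l' < l → l ≤ j → (∀ k, l' < k → k < l → ¬ T k ∧ ¬ M k) →
        levelMass f A l' (Set.Ici (a + 4 * h)) ≤ levelMass f A l (Set.Ioi (a + 3 * h)) +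
          c * (layerEnergy m A l' - layerEnergy m A l) / h ^ 2 := by
      intro l' l h1 h2 h3 hgood
      have := ih (i := l') (j := l) (a := a + 3 * h) (b := a + 4 * h) h2.le (by linarith)
        fun k hk hk' => hsub k (by omega) (by omega) _ _ (by linarith) (by linarith)
          (hgood k hk hk').1
      rwa [show a + 4 * h - (a + 3 * h) = h by ring] at this
    have hlast : ∀ l, i < l → ∃ l', i ≤ l' ∧ l' < l ∧ (l' = i ∨ T l' ∨ M l') ∧
        ∀ k, l' < k → k < l → ¬ T k ∧ ¬ M k := by
      intro l hil
      induction l, hil using Nat.le_induction with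
      | base => exact ⟨i, le_rfl, Nat.lt_succ_self i, Or.inl rfl, fun k h1 h2 => by omega⟩
      | succ l hil ih =>
        by_cases hb : T l ∨ M l
        · exact ⟨l, by omega, by omega, Or.inr hb, fun k h1 h2 => by omega⟩
        · obtain ⟨l', h1, h2, h3, h4⟩ := ih
          refine ⟨l', h1, by omega, h3, fun k h5 h6 => ?_⟩
          rcases (Nat.lt_succ_iff.1 h6).eq_or_lt with rfl | h7
          · exact not_or.1 hb
          · exact h4 k h5 h7
    set D := (c + 1) / h ^ 2 with hD
    have hDc : ∀ l' l, l' ≤ l → c * (layerEnergy m A l' - layerEnergy m A l) / h ^ 2 +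
        (layerEnergy m A l' - layerEnergy m A l) / h ^ 2 =
          D * (layerEnergy m A l' - layerEnergy m A l) := by
      intro l' l _
      rw [hD]; ring
    have hpos : ∀ l' l, l' ≤ l → 0 ≤ (layerEnergy m A l' - layerEnergy m A l) / h ^ 2 :=
      fun l' l hl => div_nonneg (sub_nonneg.2 (L.layerEnergy_anti hl)) (by positivity)
    have hG : ∀ l, i ≤ l → l < j →
        (T l → levelMass f A i (Set.Ici (a + 4 * h)) ≤ levelMass f A l (Set.Ici (a + 3 * h)) +
          D * (layerEnergy m A i - layerEnergy m A l)) ∧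
        (M l ∨ l = i → levelMass f A i (Set.Ici (a + 4 * h)) ≤
          levelMass f A l (Set.Ici (a + 4 * h)) +
            D * (layerEnergy m A i - layerEnergy m A l)) := by
      intro l
      induction l using Nat.strong_induction_on with
      | _ l ihl =>
        intro hil hlj
        rcases hil.eq_or_lt with rfl | hil
        · refine ⟨fun _ => ?_, fun _ => by simp⟩
          rw [sub_self, mul_zero, add_zero]
          refine L.levelMass_mono fun x hx => ?_
          simp only [Set.mem_Ici] at hx ⊢
          linarith
        obtain ⟨l', h1, h2, h3, h4⟩ := hlast l hil
        have hG' := ihl l' h2 h1 (by omega)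
        have hx := hX l' l h1 h2 (by omega) h4
        have hy := hY l' l h1 h2 (by omega) h4
        have hd := hDc l' l h2.le
        have hp := hpos l' l h2.le
        have hm1 : levelMass f A l' (Set.Ici (a + 3 * h)) ≤
            levelMass f A l' (Set.Ici (a + 2 * h)) :=
          L.levelMass_mono fun x hx => by
            simp only [Set.mem_Ici] at hx ⊢
            linarith
        have hm2 : levelMass f A l' (Set.Ici (a + 4 * h)) ≤
            levelMass f A l' (Set.Ici (a + 2 * h)) :=
          L.levelMass_mono fun x hx => by
            simp only [Set.mem_Ici] at hx ⊢
            linarith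
        constructor
        · intro hTl
          have hm3 : levelMass f A l (Set.Ioi (a + h)) ≤ levelMass f A l (Set.Ici (a + 3 * h)) :=
            L.levelMass_mono fun x hx => by
              simp only [Set.mem_Ici, Set.mem_Ioi] at hx ⊢
              by_contra! hlt
              have := (hTl x ⟨by linarith, by linarith⟩).1
              linarith
          rcases h3 with h3 | h3 | h3
          · have := hG'.2 (Or.inr h3); linarith
          · have := hG'.1 h3; linarith
          · have := hG'.2 (Or.inl h3); linarith
        · intro hMl
          replace hMl : M l := hMl.resolve_right (by omega)
          have hm3 : levelMass f A l (Set.Ioi (a + 3 * h)) ≤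
              levelMass f A l (Set.Ici (a + 4 * h)) :=
            L.levelMass_mono fun x hx => by
              simp only [Set.mem_Ici, Set.mem_Ioi] at hx ⊢
              by_contra! hlt
              have := (hMl x ⟨by linarith, by linarith⟩).2
              linarith
          rcases h3 with h3 | h3 | h3
          · have := hG'.2 (Or.inr h3); linarith
          · have hg := hG'.1 h3
            have hv := L.sq_mul_levelMass_le h2.le (p := a) (q := a + 3 * h) (by linarith) hh
              (fun x => by
                by_contra! hx
                have := (h3 x ⟨hx.1, by linarith⟩).1
                linarith)
            have hm4 : levelMass f A l (Set.Ioi (a + h)) ≤ levelMass f A l (Set.Ici (a + 4 * h)) +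
                levelMass m A l (Set.Icc (a + h) (a + 3 * h - h)) := by
              rw [levelMass, levelMass, levelMass, ← Finset.sum_add_distrib]
              refine Finset.sum_le_sum fun x _ => ?_
              have hf0 := L.f_nonneg l x
              have hfm := L.f_le l x
              by_cases hx1 : A l x ∈ Set.Ioi (a + h)
              · by_cases hx2 : A l x ∈ Set.Ici (a + 4 * h)
                · rw [if_pos hx1, if_pos hx2]
                  split_ifs <;> linarith
                · have hx3 := hMl x ⟨by have : a + h < A l x := hx1
                                        linarith, not_le.1 hx2⟩
                  rw [if_pos hx1, if_neg hx2, if_pos ⟨hx3.1.le, by linarith [hx3.2]⟩]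
                  linarith
              · rw [if_neg hx1]
                split_ifs <;> linarith
            linarith
          · have := hG'.2 (Or.inl h3); linarith
    obtain ⟨l', h1, h2, h3, h4⟩ := hlast j hlt
    have hG' := hG l' h1 h2
    have hx := hX l' j h1 h2 le_rfl h4
    have hd := hDc l' j h2.le
    have hp := hpos l' j h2.le
    have hm1 : levelMass f A l' (Set.Ici (a + 3 * h)) ≤ levelMass f A l' (Set.Ici (a + 2 * h)) :=
      L.levelMass_mono fun x hx => by
        simp only [Set.mem_Ici] at hx ⊢
        linarith
    have hm2 : levelMass f A l' (Set.Ici (a + 4 * h)) ≤ levelMass f A l' (Set.Ici (a + 2 * h)) :=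
      L.levelMass_mono fun x hx => by
        simp only [Set.mem_Ici] at hx ⊢
        linarith
    have hm3 : levelMass f A j (Set.Ioi (a + h)) ≤ levelMass f A j (Set.Ioi a) :=
      L.levelMass_mono fun x hx => by
        simp only [Set.mem_Ioi] at hx ⊢
        linarith
    have hfin : flowConst (K + 1) * (layerEnergy m A i - layerEnergy m A j) /
        (a + 4 * h - a) ^ 2 = D * (layerEnergy m A i - layerEnergy m A j) := by
      rw [hD, flowConst]
      field_simp
      ring
    rw [hfin]
    rcases h3 with h3 | h3 | h3
    · have := hG'.2 (Or.inr h3); linarith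
    · have := hG'.1 h3; linarith
    · have := hG'.2 (Or.inl h3); linarith

end LayeredFlow

/-- `φ` only depends on the intersection of its argument with `W`. -/
def DependsOnSet {V : Type*} [DecidableEq V] (φ : Finset V → ℝ) (W : Finset V) : Prop :=
  ∀ z, φ (z ∩ W) = φ z

/-- The expectation of `φ` under the (unnormalized) local distribution of `y` on assignments
to `W`, an assignment being encoded as the set of elements mapped to `1`. -/
def localExp {n : ℕ} (y : Finset (Fin n) → ℝ) (W : Finset (Fin n)) (φ : Finset (Fin n) → ℝ) : ℝ :=
  ∑ x ∈ W.powerset, saIJ y (W \ x) x * φ x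

section LocalDistribution

variable {n : ℕ} {y : Finset (Fin n) → ℝ}

theorem DependsOnSet.mono {V : Type*} [DecidableEq V] {φ : Finset V → ℝ} {W Q : Finset V}
    (h : DependsOnSet φ W) (hWQ : W ⊆ Q) : DependsOnSet φ Q := fun z => by
  rw [← h (z ∩ Q), ← h z, Finset.inter_assoc, Finset.inter_eq_right.2 hWQ]

theorem DependsOnSet.congr {V : Type*} [DecidableEq V] {φ : Finset V → ℝ} {W : Finset V}
    (h : DependsOnSet φ W) {z z' : Finset V} (hz : z ∩ W = z' ∩ W) : φ z = φ z' := by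
  rw [← h z, ← h z', hz]

theorem DependsOnSet.insert_eq {V : Type*} [DecidableEq V] {φ : Finset V → ℝ} {W : Finset V}
    (h : DependsOnSet φ W) {v : V} (hv : v ∉ W) (z : Finset V) : φ (insert v z) = φ z :=
  h.congr (Finset.insert_inter_of_notMem hv)

theorem DependsOnSet.erase_eq {V : Type*} [DecidableEq V] {φ : Finset V → ℝ} {W : Finset V}
    (h : DependsOnSet φ W) {v : V} (hv : v ∉ W) (z : Finset V) : φ (z.erase v) = φ z := by
  refine h.congr ?_
  rw [Finset.erase_inter, Finset.erase_eq_of_notMem]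
  exact fun hm => hv (Finset.mem_inter.1 hm).2

theorem DependsOnSet.comp {V : Type*} [DecidableEq V] {φ : Finset V → ℝ} {W : Finset V}
    (h : DependsOnSet φ W) (g : ℝ → ℝ) : DependsOnSet (fun z => g (φ z)) W := fun z => by
  simp only [h z]

theorem DependsOnSet.comp₂ {V : Type*} [DecidableEq V] {φ ψ : Finset V → ℝ} {W : Finset V}
    (h : DependsOnSet φ W) (h' : DependsOnSet ψ W) (g : ℝ → ℝ → ℝ) :
    DependsOnSet (fun z => g (φ z) (ψ z)) W := fun z => by
  simp only [h z, h' z]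

theorem DependsOnSet.mul {V : Type*} [DecidableEq V] {φ ψ : Finset V → ℝ} {W : Finset V}
    (h : DependsOnSet φ W) (h' : DependsOnSet ψ W) : DependsOnSet (fun z => φ z * ψ z) W :=
  h.comp₂ h' fun a b => a * b

theorem dependsOnSet_inter {V : Type*} [DecidableEq V] (h : Finset V → ℝ) (W : Finset V) :
    DependsOnSet (fun z => h (z ∩ W)) W := fun z => by
  simp only [Finset.inter_assoc, Finset.inter_self]

theorem saIJ_insert {v : Fin n} {I : Finset (Fin n)} (hv : v ∉ I) (J : Finset (Fin n)) :
    saIJ y (insert v I) J = saIJ y I J - saIJ y I (insert v J) := by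
  rw [saIJ, Finset.sum_powerset_insert hv, saIJ, saIJ, sub_eq_add_neg, ← Finset.sum_neg_distrib]
  congr 1
  refine Finset.sum_congr rfl fun t ht => ?_
  rw [Finset.card_insert_of_notMem fun h => hv (Finset.mem_powerset.1 ht h), Finset.insert_union,
    Finset.union_insert, pow_succ]
  ring

theorem localExp_insert {v : Fin n} {W : Finset (Fin n)} (hv : v ∉ W) (φ : Finset (Fin n) → ℝ) :
    localExp y (insert v W) φ = ∑ x ∈ W.powerset,
      ((saIJ y (W \ x) x - saIJ y (W \ x) (insert v x)) * φ x +
        saIJ y (W \ x) (insert v x) * φ (insert v x)) := by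
  rw [localExp, Finset.sum_powerset_insert hv, ← Finset.sum_add_distrib]
  refine Finset.sum_congr rfl fun x hx => ?_
  have hvx : v ∉ x := fun h => hv (Finset.mem_powerset.1 hx h)
  rw [Finset.insert_sdiff_of_notMem _ hvx, saIJ_insert (by simp [hv]),
    Finset.insert_sdiff_insert, Finset.sdiff_insert, Finset.erase_eq_of_notMem (by simp [hv])]

theorem localExp_congr {W : Finset (Fin n)} {φ ψ : Finset (Fin n) → ℝ}
    (h : ∀ x, x ⊆ W → φ x = ψ x) : localExp y W φ = localExp y W ψ :=
  Finset.sum_congr rfl fun x hx => by rw [h x (Finset.mem_powerset.1 hx)]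

theorem localExp_eq_of_subset {W Q : Finset (Fin n)} (hWQ : W ⊆ Q) {φ : Finset (Fin n) → ℝ}
    (hφ : DependsOnSet φ W) : localExp y Q φ = localExp y W φ := by
  have h : ∀ N : Finset (Fin n), Disjoint N W → localExp y (N ∪ W) φ = localExp y W φ := by
    intro N
    induction N using Finset.induction_on with
    | empty => simp
    | insert v N hvN ih =>
      intro hd
      rw [Finset.disjoint_insert_left] at hd
      rw [Finset.insert_union, localExp_insert (by simp [hvN, hd.1]), ← ih hd.2]
      refine Finset.sum_congr rfl fun x _ => ?_
      rw [hφ.insert_eq hd.1]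
      ring
  rw [← h (Q \ W) Finset.sdiff_disjoint, Finset.sdiff_union_of_subset hWQ]

theorem localExp_add (W : Finset (Fin n)) (φ ψ : Finset (Fin n) → ℝ) :
    localExp y W (fun z => φ z + ψ z) = localExp y W φ + localExp y W ψ := by
  simp only [localExp, mul_add, Finset.sum_add_distrib]

theorem localExp_sub (W : Finset (Fin n)) (φ ψ : Finset (Fin n) → ℝ) :
    localExp y W (fun z => φ z - ψ z) = localExp y W φ - localExp y W ψ := by
  simp only [localExp, mul_sub, Finset.sum_sub_distrib]

theorem localExp_const_mul (W : Finset (Fin n)) (c : ℝ) (φ : Finset (Fin n) → ℝ) :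
    localExp y W (fun z => c * φ z) = c * localExp y W φ := by
  simp only [localExp, Finset.mul_sum]
  exact Finset.sum_congr rfl fun x _ => by ring

theorem localExp_sum {ι : Type*} (s : Finset ι) (W : Finset (Fin n))
    (φ : ι → Finset (Fin n) → ℝ) :
    localExp y W (fun z => ∑ i ∈ s, φ i z) = ∑ i ∈ s, localExp y W (φ i) := by
  simp only [localExp, Finset.mul_sum]
  exact Finset.sum_comm

theorem saIJ_sdiff_nonneg {t : ℕ} (hy : memSA t y) {W x : Finset (Fin n)} (hW : W.card ≤ t)
    (hx : x ⊆ W) : 0 ≤ saIJ y (W \ x) x :=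
  hy _ _ (by rwa [Finset.sdiff_union_of_subset hx])

theorem localExp_mono {t : ℕ} (hy : memSA t y) {W : Finset (Fin n)} (hW : W.card ≤ t)
    {φ ψ : Finset (Fin n) → ℝ} (h : ∀ x, φ x ≤ ψ x) : localExp y W φ ≤ localExp y W ψ :=
  Finset.sum_le_sum fun x hx => mul_le_mul_of_nonneg_left (h x)
    (saIJ_sdiff_nonneg hy hW (Finset.mem_powerset.1 hx))

theorem localExp_nonneg {t : ℕ} (hy : memSA t y) {W : Finset (Fin n)} (hW : W.card ≤ t)
    {φ : Finset (Fin n) → ℝ} (h : ∀ x, 0 ≤ φ x) : 0 ≤ localExp y W φ :=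
  Finset.sum_nonneg fun x hx => mul_nonneg
    (saIJ_sdiff_nonneg hy hW (Finset.mem_powerset.1 hx)) (h x)

/-- The conditional probability that `v` is mapped to `1` given the assignment `f` on `p`. -/
noncomputable def condProb (y : Finset (Fin n) → ℝ) (v : Fin n) (p f : Finset (Fin n)) : ℝ :=
  saIJ y (p \ f) (insert v (f ∩ p)) / saIJ y (p \ f) (f ∩ p)

/-- The operator resampling `v` conditionally on the assignment to `p`. -/
noncomputable def resample (y : Finset (Fin n) → ℝ) (v : Fin n) (p : Finset (Fin n))
    (φ : Finset (Fin n) → ℝ) (f : Finset (Fin n)) : ℝ :=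
  (1 - condProb y v p f) * φ (f.erase v) + condProb y v p f * φ (insert v f)

theorem condProb_dependsOnSet (v : Fin n) (p : Finset (Fin n)) :
    DependsOnSet (condProb y v p) p := fun z => by
  have he : p \ (z ∩ p) = p \ z := by ext i; simp
  simp only [condProb, he, Finset.inter_assoc, Finset.inter_self]

theorem saIJ_insert_le {t : ℕ} (hy : memSA t y) {v : Fin n} {p x : Finset (Fin n)} (hv : v ∉ p)
    (hp : p.card + 1 ≤ t) (hx : x ⊆ p) :
    0 ≤ saIJ y (p \ x) (insert v x) ∧ saIJ y (p \ x) (insert v x) ≤ saIJ y (p \ x) x := by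
  have hcard : (insert v p).card ≤ t := by rwa [Finset.card_insert_of_notMem hv]
  constructor
  · refine hy _ _ (le_trans (Finset.card_le_card ?_) hcard)
    rw [Finset.union_insert, Finset.sdiff_union_of_subset hx]
  · have h := hy (insert v (p \ x)) x (le_trans (Finset.card_le_card (by
      rw [Finset.insert_union, Finset.sdiff_union_of_subset hx])) hcard)
    rw [saIJ_insert (by simp [hv])] at h
    linarith

theorem condProb_mem {t : ℕ} (hy : memSA t y) {v : Fin n} {p : Finset (Fin n)} (hv : v ∉ p)
    (hp : p.card + 1 ≤ t) (f : Finset (Fin n)) :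
    0 ≤ condProb y v p f ∧ condProb y v p f ≤ 1 := by
  have h := saIJ_insert_le hy hv hp (Finset.inter_subset_right : f ∩ p ⊆ p)
  have he : p \ (f ∩ p) = p \ f := by ext i; simp
  rw [he] at h
  exact ⟨div_nonneg h.1 (h.1.trans h.2), div_le_one_of_le₀ h.2 (h.1.trans h.2)⟩

theorem saIJ_mul_condProb {t : ℕ} (hy : memSA t y) {v : Fin n} {p x : Finset (Fin n)}
    (hv : v ∉ p) (hp : p.card + 1 ≤ t) (hx : x ⊆ p) :
    saIJ y (p \ x) x * condProb y v p x = saIJ y (p \ x) (insert v x) := by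
  have h := saIJ_insert_le hy hv hp hx
  rw [condProb, Finset.inter_eq_left.2 hx]
  by_cases h0 : saIJ y (p \ x) x = 0
  · rw [h0, zero_mul]
    rw [h0] at h
    exact le_antisymm h.1 h.2
  · field_simp

theorem resample_dependsOnSet {v : Fin n} {p W : Finset (Fin n)} {φ : Finset (Fin n) → ℝ}
    (hφ : DependsOnSet φ W) (hW : W ⊆ insert v p) : DependsOnSet (resample y v p φ) p := by
  intro z
  rw [resample, resample, condProb_dependsOnSet]
  have h1 : φ ((z ∩ p).erase v) = φ (z.erase v) := hφ.congr <| by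
    ext i
    have := @hW i
    simp only [Finset.mem_inter, Finset.mem_erase, Finset.mem_insert] at *
    tauto
  have h2 : φ (insert v (z ∩ p)) = φ (insert v z) := hφ.congr <| by
    ext i
    have := @hW i
    simp only [Finset.mem_inter, Finset.mem_insert] at *
    tauto
  rw [h1, h2]

theorem resample_mul {v : Fin n} {p W : Finset (Fin n)} {ψ : Finset (Fin n) → ℝ}
    (hψ : DependsOnSet ψ W) (hv : v ∉ W) (φ : Finset (Fin n) → ℝ) (z : Finset (Fin n)) :
    resample y v p (fun z => φ z * ψ z) z = resample y v p φ z * ψ z := by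
  simp only [resample, hψ.insert_eq hv, hψ.erase_eq hv]
  ring

theorem resample_eq_self {v : Fin n} {p W : Finset (Fin n)} {φ : Finset (Fin n) → ℝ}
    (hφ : DependsOnSet φ W) (hv : v ∉ W) : resample y v p φ = φ := by
  funext z
  rw [resample, hφ.insert_eq hv, hφ.erase_eq hv]
  ring

theorem resample_add (v : Fin n) (p : Finset (Fin n)) (φ ψ : Finset (Fin n) → ℝ) :
    resample y v p (fun z => φ z + ψ z) =
      fun z => resample y v p φ z + resample y v p ψ z := by
  funext z
  simp only [resample]
  ring

theorem resample_const_mul (v : Fin n) (p : Finset (Fin n)) (c : ℝ) (φ : Finset (Fin n) → ℝ) :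
    resample y v p (fun z => c * φ z) = fun z => c * resample y v p φ z := by
  funext z
  simp only [resample]
  ring

theorem resample_mono {t : ℕ} (hy : memSA t y) {v : Fin n} {p : Finset (Fin n)} (hv : v ∉ p)
    (hp : p.card + 1 ≤ t) {φ ψ : Finset (Fin n) → ℝ} (h : ∀ x, φ x ≤ ψ x) (z : Finset (Fin n)) :
    resample y v p φ z ≤ resample y v p ψ z := by
  have hc := condProb_mem hy hv hp z
  exact add_le_add (mul_le_mul_of_nonneg_left (h _) (by linarith))
    (mul_le_mul_of_nonneg_left (h _) hc.1)

theorem resample_const (v : Fin n) (p : Finset (Fin n)) (c : ℝ) (z : Finset (Fin n)) :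
    resample y v p (fun _ => c) z = c := by
  simp only [resample]
  ring

theorem localExp_insert_eq_resample {t : ℕ} (hy : memSA t y) {v : Fin n} {p : Finset (Fin n)}
    (hv : v ∉ p) (hp : p.card + 1 ≤ t) (φ : Finset (Fin n) → ℝ) :
    localExp y (insert v p) φ = localExp y p (resample y v p φ) := by
  rw [localExp_insert hv, localExp]
  refine Finset.sum_congr rfl fun x hx => ?_
  rw [Finset.mem_powerset] at hx
  rw [resample, ← saIJ_mul_condProb hy hv hp hx, Finset.erase_eq_of_notMem fun h => hv (hx h)]
  ring

end LocalDistribution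

/-- `W` is a clique with respect to the elimination list `l`, whose entries consist of a vertex
and its earlier neighbours. -/
def IsCliqueIn {V : Type*} [DecidableEq V] : List (V × Finset V) → Finset V → Prop
  | [], W => W = ∅
  | (v, p) :: l, W => (v ∈ W ∧ W.erase v ⊆ p) ∨ (v ∉ W ∧ IsCliqueIn l W)

/-- `l` is a perfect elimination list of width at most `r`. -/
def IsElimination {V : Type*} [DecidableEq V] (r : ℕ) : List (V × Finset V) → Prop
  | [] => True
  | (v, p) :: l => v ∉ p ∧ p.card ≤ r ∧ IsCliqueIn l p ∧ IsElimination r l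

/-- Expectation under the random assignment sampled vertex by vertex along `l`. -/
noncomputable def sampleExp {n : ℕ} (y : Finset (Fin n) → ℝ) :
    List (Fin n × Finset (Fin n)) → (Finset (Fin n) → ℝ) → ℝ
  | [], φ => y ∅ * φ ∅
  | (v, p) :: l, φ => sampleExp y l (resample y v p φ)

section Elimination

variable {V : Type*} [DecidableEq V] {r : ℕ}

theorem IsCliqueIn.empty (l : List (V × Finset V)) : IsCliqueIn l ∅ := by
  induction l with
  | nil => rfl
  | cons a l ih => exact Or.inr ⟨Finset.notMem_empty _, ih⟩

theorem IsCliqueIn.mono {l : List (V × Finset V)} (hl : IsElimination r l) {W W' : Finset V}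
    (h : IsCliqueIn l W) (hW : W' ⊆ W) : IsCliqueIn l W' := by
  induction l generalizing W W' with
  | nil => exact Finset.subset_empty.1 (hW.trans (Finset.subset_empty.2 h))
  | cons a l ih =>
    obtain ⟨v, p⟩ := a
    obtain ⟨-, -, hp, hl⟩ := hl
    by_cases hv : v ∈ W'
    · refine Or.inl ⟨hv, ?_⟩
      rcases h with h | h
      · exact (Finset.erase_subset_erase _ hW).trans h.2
      · exact absurd (hW hv) h.1
    · refine Or.inr ⟨hv, ?_⟩
      rcases h with h | h
      · exact ih hl hp fun i hi => h.2 (Finset.mem_erase.2 ⟨fun hiv => hv (hiv ▸ hi), hW hi⟩)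
      · exact ih hl h.2 hW

theorem exists_elimination_union {l : List (V × Finset V)} (hl : IsElimination r l)
    {S : Finset V} (hS : IsCliqueIn l S) (N : Finset V) (hd : Disjoint N S)
    (hcard : (N ∪ S).card ≤ r + 1) :
    ∃ l', IsElimination r l' ∧ IsCliqueIn l' (N ∪ S) ∧
      ∀ W, Disjoint N W → IsCliqueIn l W → IsCliqueIn l' W := by
  induction N using Finset.induction_on with
  | empty => exact ⟨l, hl, by simpa using hS, fun W _ h => h⟩
  | insert v N hvN ih =>
    rw [Finset.disjoint_insert_left] at hd
    have hv : v ∉ N ∪ S := by simp [hvN, hd.1]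
    rw [Finset.insert_union, Finset.card_insert_of_notMem hv] at hcard
    obtain ⟨l', h1, h2, h3⟩ := ih hd.2 (by omega)
    refine ⟨(v, N ∪ S) :: l', ⟨hv, by omega, h2, h1⟩, ?_, fun W hW hlW => ?_⟩
    · exact Or.inl ⟨by simp, by rw [Finset.insert_union, Finset.erase_insert hv]⟩
    · rw [Finset.disjoint_insert_left] at hW
      exact Or.inr ⟨hW.1, h3 W hW.2 hlW⟩

theorem exists_walk_of_induce {ι : Type*} {T : SimpleGraph ι} {s : Set ι} {a b : s}
    (q : (T.induce s).Walk a b) : ∃ q' : T.Walk a b, ∀ x ∈ q'.support, x ∈ s := by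
  induction q with
  | nil => exact ⟨SimpleGraph.Walk.nil, by simp⟩
  | @cons u v w h q ih =>
    obtain ⟨q', hq'⟩ := ih
    have h' : T.Adj u v := h
    refine ⟨SimpleGraph.Walk.cons h' q', fun x hx => ?_⟩
    rw [SimpleGraph.Walk.support_cons, List.mem_cons] at hx
    rcases hx with rfl | hx
    · exact Subtype.property _
    · exact hq' x hx

theorem exists_elimination {V : Type} [DecidableEq V] {r : ℕ} {G : SimpleGraph V}
    (td : TreeDecomp G) (hcard : ∀ i, (td.bags i).card ≤ r + 1) :
    ∃ l, IsElimination r l ∧ ∀ i, IsCliqueIn l (td.bags i) := by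
  classical
  have := td.fintype_ι
  set P : Finset td.ι → Prop := fun s => s.Nonempty ∧
    (∀ i ∈ s, ∀ j ∈ s, ∃ q : td.T.Walk i j, ∀ k ∈ q.support, k ∈ s) ∧
    ∃ l, IsElimination r l ∧ ∀ i ∈ s, IsCliqueIn l (td.bags i) with hP
  obtain ⟨i₀⟩ := td.connected.nonempty
  have hP₀ : P {i₀} := by
    obtain ⟨l, h1, h2, -⟩ := exists_elimination_union (r := r) (l := []) trivial
      (S := ∅) rfl (td.bags i₀) (by simp) (by simpa using hcard i₀)
    refine ⟨by simp, fun i hi j hj => ?_, l, h1, fun i hi => ?_⟩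
    · rw [Finset.mem_singleton] at hi hj
      subst hi hj
      exact ⟨SimpleGraph.Walk.nil, by simp⟩
    · rw [Finset.mem_singleton] at hi
      subst hi
      simpa using h2
  obtain ⟨s, -, hs⟩ := Finite.exists_le_maximal hP₀
  obtain ⟨⟨hne, hconn, l, hl, hbags⟩, hmax⟩ := hs
  suffices h : ∀ i, i ∈ s from ⟨l, hl, fun i => hbags i (h i)⟩
  by_contra! hout
  obtain ⟨o, ho⟩ := hout
  obtain ⟨j₀, hj₀⟩ := hne
  obtain ⟨q⟩ := td.connected.preconnected j₀ o
  obtain ⟨d, -, hd1, hd2⟩ := q.exists_boundary_dart (↑s) hj₀ ho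
  obtain ⟨⟨p, i⟩, hadj⟩ := d
  simp only [Finset.mem_coe] at hd1 hd2
  replace hadj : td.T.Adj p i := hadj
  have hrip : ∀ v ∈ td.bags i, ∀ k ∈ s, v ∈ td.bags k → v ∈ td.bags p := by
    intro v hvi k hk hvk
    by_contra hvp
    obtain ⟨q1⟩ := (td.bags_connected v).preconnected ⟨i, hvi⟩ ⟨k, hvk⟩
    obtain ⟨q2, hq2⟩ := hconn k hk p hd1
    obtain ⟨q1', hq1⟩ := exists_walk_of_induce q1
    have hbridge := SimpleGraph.isAcyclic_iff_forall_adj_isBridge.1 td.acyclic hadj.symm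
    rw [SimpleGraph.isBridge_iff_forall_walk_mem_edges] at hbridge
    have := hbridge (q1'.append q2)
    rw [SimpleGraph.Walk.edges_append, List.mem_append] at this
    rcases this with h | h
    · exact hvp (hq1 _ (SimpleGraph.Walk.snd_mem_support_of_mem_edges _ h))
    · exact hd2 (hq2 _ (SimpleGraph.Walk.fst_mem_support_of_mem_edges _ h))
  have hS : IsCliqueIn l (td.bags i ∩ td.bags p) := (hbags p hd1).mono hl Finset.inter_subset_right
  obtain ⟨l', h1, h2, h3⟩ := exists_elimination_union hl hS (td.bags i \ td.bags p)
    (Finset.disjoint_left.2 fun x hx hx' =>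
      (Finset.mem_sdiff.1 hx).2 (Finset.mem_inter.1 hx').2)
    (by rw [Finset.sdiff_union_inter]; exact hcard i)
  rw [Finset.sdiff_union_inter] at h2
  have hPi : P (insert i s) := by
    refine ⟨by simp, ?_, l', h1, fun k hk => ?_⟩
    · have hi : ∀ k ∈ s, ∃ q : td.T.Walk i k, ∀ x ∈ q.support, x ∈ insert i s := by
        intro k hk
        obtain ⟨q, hq⟩ := hconn p hd1 k hk
        refine ⟨SimpleGraph.Walk.cons hadj.symm q, fun x hx => ?_⟩
        rw [SimpleGraph.Walk.support_cons, List.mem_cons] at hx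
        rcases hx with rfl | hx
        · exact Finset.mem_insert_self _ _
        · exact Finset.mem_insert_of_mem (hq x hx)
      intro a ha b hb
      rcases Finset.mem_insert.1 ha with rfl | ha'
      · rcases Finset.mem_insert.1 hb with rfl | hb'
        · exact ⟨SimpleGraph.Walk.nil, by simp⟩
        · exact hi b hb'
      · rcases Finset.mem_insert.1 hb with rfl | hb'
        · obtain ⟨q, hq⟩ := hi a ha'
          exact ⟨q.reverse, fun x hx => hq x (by simpa using hx)⟩
        · obtain ⟨q, hq⟩ := hconn a ha' b hb'
          exact ⟨q, fun x hx => Finset.mem_insert_of_mem (hq x hx)⟩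
    · rcases Finset.mem_insert.1 hk with rfl | hk
      · exact h2
      · refine h3 _ (Finset.disjoint_left.2 fun v hv hvk => ?_) (hbags k hk)
        rw [Finset.mem_sdiff] at hv
        exact hv.2 (hrip v hv.1 k hk hvk)
  exact hd2 (hmax hPi (Finset.subset_insert i s) (Finset.mem_insert_self i s))

end Elimination

section Sampling

variable {n r : ℕ} {y : Finset (Fin n) → ℝ}

theorem sampleExp_add (l : List (Fin n × Finset (Fin n))) (φ ψ : Finset (Fin n) → ℝ) :
    sampleExp y l (fun z => φ z + ψ z) = sampleExp y l φ + sampleExp y l ψ := by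
  induction l generalizing φ ψ with
  | nil => simp only [sampleExp]; ring
  | cons a l ih => rw [sampleExp, resample_add, ih]; rfl

theorem sampleExp_const_mul (l : List (Fin n × Finset (Fin n))) (c : ℝ)
    (φ : Finset (Fin n) → ℝ) : sampleExp y l (fun z => c * φ z) = c * sampleExp y l φ := by
  induction l generalizing φ with
  | nil => simp only [sampleExp]; ring
  | cons a l ih => rw [sampleExp, resample_const_mul, ih]; rfl

theorem sampleExp_sum {ι : Type*} (s : Finset ι) (l : List (Fin n × Finset (Fin n)))
    (φ : ι → Finset (Fin n) → ℝ) :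
    sampleExp y l (fun z => ∑ i ∈ s, φ i z) = ∑ i ∈ s, sampleExp y l (φ i) := by
  classical
  induction s using Finset.induction_on with
  | empty =>
    have := sampleExp_const_mul (y := y) l 0 fun _ => 0
    simpa using this
  | insert i s hi ih => simp only [Finset.sum_insert hi, sampleExp_add, ih]

theorem sampleExp_mono (hy : memSA (r + 3) y) {l : List (Fin n × Finset (Fin n))}
    (hl : IsElimination r l) {φ ψ : Finset (Fin n) → ℝ} (h : ∀ x, φ x ≤ ψ x) :
    sampleExp y l φ ≤ sampleExp y l ψ := by
  induction l generalizing φ ψ with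
  | nil =>
    refine mul_le_mul_of_nonneg_left (h ∅) ?_
    have := hy ∅ ∅ (by simp)
    simpa [saIJ] using this
  | cons a l ih =>
    obtain ⟨h1, h2, -, h4⟩ := hl
    exact ih h4 (resample_mono hy h1 (by omega) h)

theorem sampleExp_eq_localExp (hy : memSA (r + 3) y) {l : List (Fin n × Finset (Fin n))}
    (hl : IsElimination r l) {W : Finset (Fin n)} (hW : IsCliqueIn l W)
    {φ : Finset (Fin n) → ℝ} (hφ : DependsOnSet φ W) :
    sampleExp y l φ = localExp y W φ := by
  induction l generalizing W φ with
  | nil =>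
    have : W = ∅ := hW
    subst this
    simp [sampleExp, localExp, saIJ]
  | cons a l ih =>
    obtain ⟨v, p⟩ := a
    obtain ⟨h1, h2, h3, h4⟩ := hl
    rw [sampleExp]
    rcases hW with ⟨hv, hW⟩ | ⟨hv, hW⟩
    · rw [← Finset.subset_insert_iff] at hW
      rw [ih h4 h3 (resample_dependsOnSet hφ hW),
        ← localExp_insert_eq_resample hy h1 (by omega), localExp_eq_of_subset hW hφ]
    · rw [resample_eq_self hφ hv, ih h4 hW hφ]

end Sampling

/-- `Ps` is a sequence of separators starting at `{s}`, and `as` the sequence of functions obtained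
from `g` by successively taking conditional expectations along it. -/
structure IsCondChainSeq {n : ℕ} (y : Finset (Fin n) → ℝ) (r : ℕ) (s : Fin n)
    (g : Finset (Fin n) → ℝ) (Ps : ℕ → Finset (Fin n)) (as : ℕ → Finset (Fin n) → ℝ) : Prop where
  zero_set : Ps 0 = {s}
  zero_fun : as 0 = g
  card_le : ∀ k, (Ps k).card ≤ r
  dependsOn : ∀ k, DependsOnSet (as k) (Ps k)
  mem_unit : ∀ k f, 0 ≤ as k f ∧ as k f ≤ 1
  card_union_le : ∀ k, (Ps k ∪ Ps (k + 1)).card ≤ r + 1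
  condExp : ∀ k ψ, DependsOnSet ψ (Ps (k + 1)) →
    localExp y (Ps k ∪ Ps (k + 1)) (fun z => as k z * ψ z) =
      localExp y (Ps (k + 1)) fun z => as (k + 1) z * ψ z

/-- `a`, a function of the assignment to `P`, is obtained from `g` by finitely many successive
conditional expectations. -/
def IsCondChain {n : ℕ} (y : Finset (Fin n) → ℝ) (r : ℕ) (s : Fin n)
    (g : Finset (Fin n) → ℝ) (P : Finset (Fin n)) (a : Finset (Fin n) → ℝ) : Prop :=
  ∃ Ps as N, IsCondChainSeq y r s g Ps as ∧ Ps N = P ∧ as N = a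

section Chain

variable {n r : ℕ} {y : Finset (Fin n) → ℝ} {s : Fin n} {g a : Finset (Fin n) → ℝ}
  {P : Finset (Fin n)}

theorem IsCondChain.start (hr : 0 < r) (hg : DependsOnSet g {s}) (hg01 : ∀ z, 0 ≤ g z ∧ g z ≤ 1) :
    IsCondChain y r s g {s} g :=
  ⟨fun _ => {s}, fun _ => g, 0, ⟨rfl, rfl, fun _ => by rwa [Finset.card_singleton],
    fun _ => hg, fun _ => hg01, fun _ => by simp, fun _ _ _ => by simp⟩, rfl, rfl⟩

theorem IsCondChain.dependsOn (h : IsCondChain y r s g P a) : DependsOnSet a P := by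
  obtain ⟨Ps, as, N, h, rfl, rfl⟩ := h
  exact h.dependsOn N

theorem IsCondChain.card_le (h : IsCondChain y r s g P a) : P.card ≤ r := by
  obtain ⟨Ps, as, N, h, rfl, rfl⟩ := h
  exact h.card_le N

theorem IsCondChain.mem_unit (h : IsCondChain y r s g P a) (z : Finset (Fin n)) :
    0 ≤ a z ∧ a z ≤ 1 := by
  obtain ⟨Ps, as, N, h, rfl, rfl⟩ := h
  exact h.mem_unit N z

theorem IsCondChain.step (hy : memSA (r + 3) y) (h : IsCondChain y r s g P a) {v : Fin n}
    {p : Finset (Fin n)} (hv : v ∉ p) (hp : p.card ≤ r) (hvP : v ∈ P) (hP : P ⊆ insert v p) :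
    IsCondChain y r s g p (resample y v p a) := by
  have ha := h.dependsOn
  have ha01 := h.mem_unit
  obtain ⟨Ps, as, N, h, rfl, rfl⟩ := h
  have hK := resample_dependsOnSet (y := y) ha hP
  have hun : Ps N ∪ p = insert v p := by
    refine Finset.Subset.antisymm (Finset.union_subset hP (Finset.subset_insert v p)) ?_
    exact Finset.insert_subset (Finset.mem_union_left _ hvP) Finset.subset_union_right
  refine ⟨fun k => if k ≤ N then Ps k else p,
    fun k => if k ≤ N then as k else resample y v p (as N), N + 1,
    ⟨by simpa using h.zero_set, by simpa using h.zero_fun, fun k => ?_, fun k => ?_,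
      fun k z => ?_, fun k => ?_, fun k ψ hψ => ?_⟩, by simp, by simp⟩
  · split_ifs
    exacts [h.card_le k, hp]
  · split_ifs
    exacts [h.dependsOn k, hK]
  · split_ifs
    · exact h.mem_unit k z
    · have h0 := resample_mono hy hv (by omega) (fun x => (ha01 x).1) z
      have h1 := resample_mono hy hv (by omega) (fun x => (ha01 x).2) z
      rw [resample_const] at h0 h1
      exact ⟨h0, h1⟩
  · rcases lt_trichotomy k N with hk | rfl | hk
    · simpa [hk.le, Nat.succ_le_of_lt hk] using h.card_union_le k
    · simpa [hun, Finset.card_insert_of_notMem hv] using hp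
    · simp only [not_le.2 hk, not_le.2 (Nat.lt_succ_of_lt hk), if_false, Finset.union_self]
      omega
  · rcases lt_trichotomy k N with hk | rfl | hk
    · simp only [Nat.succ_le_of_lt hk, if_true] at hψ
      simpa [hk.le, Nat.succ_le_of_lt hk] using h.condExp k ψ hψ
    · simp only [Nat.not_succ_le_self, if_false] at hψ
      simp only [le_refl, if_true, Nat.not_succ_le_self, if_false, hun]
      rw [localExp_insert_eq_resample hy hv (by omega)]
      exact localExp_congr fun x _ => resample_mul hψ hv _ _
    · simp only [not_le.2 hk, not_le.2 (Nat.lt_succ_of_lt hk), if_false, Finset.union_self]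

open scoped Classical in
theorem IsCondChainSeq.layeredFlow {Ps : ℕ → Finset (Fin n)} {as : ℕ → Finset (Fin n) → ℝ}
    (hy : memSA (r + 3) y) (hg : DependsOnSet g {s}) (hg01 : ∀ z, 0 ≤ g z ∧ g z ≤ 1)
    (h : IsCondChainSeq y r s g Ps as) :
    LayeredFlow
      (fun k x x' => localExp y (Ps k ∪ Ps (k + 1)) fun z =>
        (if z ∩ Ps k = x then 1 else 0) * (if z ∩ Ps (k + 1) = x' then 1 else 0))
      (fun k x x' => localExp y (insert s (Ps k ∪ Ps (k + 1))) fun z =>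
        g z * ((if z ∩ Ps k = x then 1 else 0) * (if z ∩ Ps (k + 1) = x' then 1 else 0)))
      (fun k x => localExp y (Ps k) fun z => if z ∩ Ps k = x then 1 else 0)
      (fun k x => localExp y (insert s (Ps k)) fun z => g z * (if z ∩ Ps k = x then 1 else 0))
      (fun k x => if x ⊆ Ps k then as k x else 0) := by
  have hind : ∀ k x, DependsOnSet (fun z => if z ∩ Ps k = x then (1 : ℝ) else 0) (Ps k) :=
    fun k x => dependsOnSet_inter (fun z => if z = x then (1 : ℝ) else 0) (Ps k)
  have hcard : ∀ k, (insert s (Ps k ∪ Ps (k + 1))).card ≤ r + 3 := fun k =>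
    (Finset.card_insert_le _ _).trans (by have := h.card_union_le k; omega)
  have hpair : ∀ k x x', DependsOnSet (fun z => (if z ∩ Ps k = x then (1 : ℝ) else 0) *
      (if z ∩ Ps (k + 1) = x' then 1 else 0)) (Ps k ∪ Ps (k + 1)) := fun k x x' =>
    ((hind k x).mono Finset.subset_union_left).mul
      ((hind (k + 1) x').mono Finset.subset_union_right)
  have hgs : ∀ Q, DependsOnSet g (insert s Q) := fun Q => hg.mono (by simp)
  constructor
  · intro k x x'
    refine localExp_nonneg hy (hcard k) fun z => mul_nonneg (hg01 z).1 ?_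
    positivity
  · intro k x x'
    rw [← localExp_eq_of_subset (Finset.subset_insert s _) (hpair k x x')]
    refine localExp_mono hy (hcard k) fun z => mul_le_of_le_one_left ?_ (hg01 z).2
    positivity
  · intro k x
    rw [← localExp_sum, ← localExp_eq_of_subset (Q := Ps k ∪ Ps (k + 1))
      Finset.subset_union_left (hind k x)]
    simp
  · intro k x
    rw [← localExp_sum, ← localExp_eq_of_subset (Q := Ps k ∪ Ps (k + 1))
      Finset.subset_union_right (hind (k + 1) x)]
    simp
  · intro k x
    rw [← localExp_sum, ← localExp_eq_of_subset (Q := insert s (Ps k ∪ Ps (k + 1)))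
      (Finset.insert_subset_insert _ Finset.subset_union_left)
      ((hgs _).mul ((hind k x).mono (Finset.subset_insert s _)))]
    simp
  · intro k x
    rw [← localExp_sum, ← localExp_eq_of_subset (Q := insert s (Ps k ∪ Ps (k + 1)))
      (Finset.insert_subset_insert _ Finset.subset_union_right)
      ((hgs _).mul ((hind (k + 1) x).mono (Finset.subset_insert s _)))]
    simp
  · intro k x
    have h1 := h.condExp k _ (hind (k + 1) x)
    simp_rw [mul_comm (localExp _ _ _), ← localExp_const_mul]
    rw [← localExp_sum]
    refine Eq.trans (localExp_congr fun z _ => ?_) (h1.trans (localExp_congr fun z _ => ?_))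
    · by_cases hz : z ∩ Ps (k + 1) = x
      · simp [hz, h.dependsOn k z]
      · simp [hz]
    · split_ifs with hz hz'
      · rw [← hz, h.dependsOn]
      · exact absurd (hz ▸ Finset.inter_subset_right) hz'
      · simp
      · simp

theorem IsCondChain.localExp_eq (h : IsCondChain y r s g P a) :
    localExp y {s} g = localExp y P a := by
  obtain ⟨Ps, as, N, h, rfl, rfl⟩ := h
  induction N with
  | zero => rw [h.zero_set, h.zero_fun]
  | succ k ih =>
    have := h.condExp k (fun _ => 1) fun _ => rfl
    simp only [mul_one] at this
    rw [ih, ← this, localExp_eq_of_subset Finset.subset_union_left (h.dependsOn k)]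

open scoped Classical in
theorem IsCondChain.localExp_le (hy : memSA (r + 3) y) (hg : DependsOnSet g {s})
    (hg01 : ∀ z, g z = 0 ∨ g z = 1) (h : IsCondChain y r s g P a) :
    localExp y (insert s P) (fun z => if a z ≤ 1 / 2 then g z else 0) ≤
      4 * flowConst (2 ^ r) * localExp y P fun z => a z * (1 - a z) := by
  have heq := h.localExp_eq
  obtain ⟨Ps, as, N, h, rfl, rfl⟩ := h
  have hg' : ∀ z, 0 ≤ g z ∧ g z ≤ 1 := fun z => by
    rcases hg01 z with h | h <;> rw [h] <;> norm_num
  have L := h.layeredFlow hy hg hg'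
  have key := L.levelMass_le (2 ^ r) (i := 0) (j := N) (a := 1 / 2) (b := 1) (Nat.zero_le _)
    (by norm_num) fun l _ _ => by
      refine (Set.ncard_le_ncard (t := ((Ps l).powerset : Set (Finset (Fin n)))) ?_
        (Finset.finite_toSet _)).trans ?_
      · intro x hx
        simp only [Set.mem_ofPred_eq] at hx
        split_ifs at hx with hxP
        · simpa using hxP
        · have := hx.1
          norm_num at this
      · rw [Set.ncard_coe_finset, Finset.card_powerset]
        exact Nat.pow_le_pow_right (by norm_num) (h.card_le l)
  have hmass : ∀ k S, levelMass
      (fun k x => localExp y (insert s (Ps k)) fun z => g z * (if z ∩ Ps k = x then 1 else 0))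
      (fun k x => if x ⊆ Ps k then as k x else 0) k S =
        localExp y (insert s (Ps k)) fun z => S.indicator (fun _ => g z) (as k z) := by
    intro k S
    have : ∀ x, (if (if x ⊆ Ps k then as k x else 0) ∈ S then
        localExp y (insert s (Ps k)) fun z => g z * (if z ∩ Ps k = x then 1 else 0) else 0) =
        localExp y (insert s (Ps k)) fun z => if z ∩ Ps k = x then
          (if (if x ⊆ Ps k then as k x else 0) ∈ S then g z else 0) else 0 := by
      intro x
      split_ifs <;> simp [localExp]
    rw [levelMass]
    simp_rw [this]
    rw [← localExp_sum]
    refine localExp_congr fun z _ => ?_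
    simp [h.dependsOn k z, Set.indicator_apply]
  have henergy : ∀ k, layerEnergy
      (fun k x => localExp y (Ps k) fun z => if z ∩ Ps k = x then 1 else 0)
      (fun k x => if x ⊆ Ps k then as k x else 0) k = localExp y (Ps k) fun z => as k z ^ 2 := by
    intro k
    rw [layerEnergy]
    simp_rw [mul_comm (localExp _ _ _), ← localExp_const_mul]
    rw [← localExp_sum]
    refine localExp_congr fun z _ => ?_
    simp [h.dependsOn k z]
  rw [hmass, hmass, henergy, henergy, h.zero_set, h.zero_fun, Finset.insert_eq_of_mem
    (Finset.mem_singleton_self s)] at key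
  have h0 : (localExp y {s} fun z => (Set.Ici 1).indicator (fun _ => g z) (g z)) =
      localExp y {s} g := localExp_congr fun z _ => by rcases hg01 z with h | h <;> simp [h]
  have h1 : (localExp y {s} fun z => g z ^ 2) = localExp y (Ps N) (as N) := by
    rw [← heq]
    exact localExp_congr fun z _ => by rcases hg01 z with h | h <;> simp [h]
  have h2 : localExp y {s} g =
      localExp y (insert s (Ps N)) (fun z => (Set.Ioi (1 / 2)).indicator (fun _ => g z) (as N z)) +
        localExp y (insert s (Ps N)) (fun z => if as N z ≤ 1 / 2 then g z else 0) := by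
    rw [← localExp_eq_of_subset (Q := insert s (Ps N)) (by simp) hg, ← localExp_add]
    refine localExp_congr fun z _ => ?_
    by_cases hz : as N z ≤ 1 / 2
    · rw [Set.indicator_of_notMem (by simpa using hz), if_pos hz, zero_add]
    · rw [Set.indicator_of_mem (by simpa using hz), if_neg hz, add_zero]
  have h3 : (localExp y (Ps N) fun z => as N z * (1 - as N z)) =
      localExp y (Ps N) (as N) - localExp y (Ps N) fun z => as N z ^ 2 := by
    rw [← localExp_sub]
    exact localExp_congr fun z _ => by ring
  rw [h0, h1, h2] at key
  rw [h3]
  norm_num at key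
  linarith

end Chain

section Pair

variable {n r : ℕ} {y : Finset (Fin n) → ℝ} {s t : Fin n} {g g' a b : Finset (Fin n) → ℝ}
  {P W : Finset (Fin n)}

theorem IsCondChain.localExp_mul_le (hy : memSA (r + 3) y) (hg : DependsOnSet g {s})
    (hg01 : ∀ z, g z = 0 ∨ g z = 1) (hg' : DependsOnSet g' {t})
    (hg'01 : ∀ z, g' z = 0 ∨ g' z = 1) (ha : IsCondChain y r s g P a)
    (hb : IsCondChain y r t g' W b) {Q : Finset (Fin n)} (hP : P ⊆ Q) (hW : W ⊆ Q)
    (hQ : Q.card ≤ r + 1) :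
    localExp y {s, t} (fun z => g z * g' z) ≤ (8 * flowConst (2 ^ r) + 4) *
      localExp y Q fun z => a z * b z + (1 - a z) * (1 - b z) := by
  have hda := ha.dependsOn
  have hdb := hb.dependsOn
  have ha01 := ha.mem_unit
  have hb01 := hb.mem_unit
  have h1 := ha.localExp_le hy hg hg01
  have h2 := hb.localExp_le hy hg' hg'01
  have hF := flowConst_pos (2 ^ r)
  have hR : (Q ∪ {s, t}).card ≤ r + 3 :=
    (Finset.card_union_le _ _).trans (by have := Finset.card_le_two (a := s) (b := t); omega)
  have hsub : ∀ {v : Fin n} {P : Finset (Fin n)}, v ∈ ({s, t} : Finset (Fin n)) → P ⊆ Q →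
      insert v P ⊆ Q ∪ {s, t} := fun hv hP =>
    Finset.insert_subset (Finset.mem_union_right _ hv) (hP.trans Finset.subset_union_left)
  rw [← localExp_eq_of_subset (hsub (by simp) hP)
      (((hda.mono (Finset.subset_insert s P))).comp₂ (hg.mono (by simp))
        fun u v => if u ≤ 1 / 2 then v else 0),
    ← localExp_eq_of_subset (hP.trans Finset.subset_union_left)
      (hda.comp fun u => u * (1 - u))] at h1
  rw [← localExp_eq_of_subset (hsub (by simp) hW)
      (((hdb.mono (Finset.subset_insert t W))).comp₂ (hg'.mono (by simp))
        fun u v => if u ≤ 1 / 2 then v else 0),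
    ← localExp_eq_of_subset (hW.trans Finset.subset_union_left)
      (hdb.comp fun u => u * (1 - u))] at h2
  rw [← localExp_eq_of_subset (Finset.subset_union_right : {s, t} ⊆ Q ∪ {s, t})
      ((hg.mono (by simp)).mul (hg'.mono (by simp))),
    ← localExp_eq_of_subset (Finset.subset_union_left : Q ⊆ Q ∪ {s, t})
      ((hda.mono hP).comp₂ (hdb.mono hW) fun u v => u * v + (1 - u) * (1 - v))]
  have h3 := localExp_mono hy hR (φ := fun z => a z * (1 - a z))
    (ψ := fun z => a z * b z + (1 - a z) * (1 - b z)) fun z => by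
      linarith only [mul_nonneg (sub_nonneg.2 (hb01 z).2) (sq_nonneg (1 - a z)),
        mul_nonneg (hb01 z).1 (sq_nonneg (a z))]
  have h4 := localExp_mono hy hR (φ := fun z => b z * (1 - b z))
    (ψ := fun z => a z * b z + (1 - a z) * (1 - b z)) fun z => by
      linarith only [mul_nonneg (sub_nonneg.2 (ha01 z).2) (sq_nonneg (1 - b z)),
        mul_nonneg (ha01 z).1 (sq_nonneg (b z))]
  have h5 := localExp_mono hy hR (φ := fun z => g z * g' z)
    (ψ := fun z => ((if a z ≤ 1 / 2 then g z else 0) + (if b z ≤ 1 / 2 then g' z else 0)) +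
      4 * (a z * b z + (1 - a z) * (1 - b z))) fun z => by
      have h6 : 0 ≤ (1 - a z) * (1 - b z) :=
        mul_nonneg (sub_nonneg.2 (ha01 z).2) (sub_nonneg.2 (hb01 z).2)
      have h7 : 0 ≤ a z * b z := mul_nonneg (ha01 z).1 (hb01 z).1
      have h8 : 1 / 2 < a z → 1 / 2 < b z → 1 ≤ 4 * (a z * b z) := fun ha hb => by
        have := mul_lt_mul'' ha hb (by norm_num) (by norm_num)
        norm_num at this
        linarith only [this]
      rcases hg01 z with h | h <;> rcases hg'01 z with h' | h' <;> rw [h, h'] <;>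
        split_ifs with hza hzb hzb
      all_goals first
        | linarith only [h6, h7]
        | linarith only [h6, h7, h8 (not_le.1 hza) (not_le.1 hzb)]
  rw [localExp_add, localExp_add, localExp_const_mul] at h5
  have h6 := mul_le_mul_of_nonneg_left h3 (mul_nonneg zero_le_four hF.le)
  have h7 := mul_le_mul_of_nonneg_left h4 (mul_nonneg zero_le_four hF.le)
  refine (h5.trans (add_le_add_left (add_le_add (h1.trans h6) (h2.trans h7)) _)).trans
    (le_of_eq ?_)
  ring

theorem resample_agreement {v : Fin n} {p : Finset (Fin n)} (hb : DependsOnSet b W)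
    (hv : v ∉ W) :
    (resample y v p fun z => a z * b z + (1 - a z) * (1 - b z)) =
      fun z => resample y v p a z * b z + (1 - resample y v p a z) * (1 - b z) := by
  funext z
  simp only [resample, hb.insert_eq hv, hb.erase_eq hv]
  ring

theorem IsCondChain.localExp_mul_le_sampleExp (hy : memSA (r + 3) y) (hg : DependsOnSet g {s})
    (hg01 : ∀ z, g z = 0 ∨ g z = 1) (hg' : DependsOnSet g' {t})
    (hg'01 : ∀ z, g' z = 0 ∨ g' z = 1) (ha : IsCondChain y r s g P a)
    (hb : IsCondChain y r t g' W b) {l : List (Fin n × Finset (Fin n))}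
    (hl : IsElimination r l) (hP : IsCliqueIn l P) (hW : IsCliqueIn l W) :
    localExp y {s, t} (fun z => g z * g' z) ≤ (8 * flowConst (2 ^ r) + 4) *
      sampleExp y l fun z => a z * b z + (1 - a z) * (1 - b z) := by
  induction l generalizing P W a b with
  | nil =>
    have hP' : P = ∅ := hP
    have hW' : W = ∅ := hW
    subst hP' hW'
    rw [sampleExp_eq_localExp hy hl (W := ∅) rfl
      (ha.dependsOn.comp₂ hb.dependsOn fun u v => u * v + (1 - u) * (1 - v))]
    exact ha.localExp_mul_le hy hg hg01 hg' hg'01 hb subset_rfl subset_rfl (by simp)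
  | cons e l ih =>
    obtain ⟨v, p⟩ := e
    obtain ⟨h1, h2, h3, h4⟩ := id hl
    rcases hP with ⟨hvP, hP⟩ | ⟨hvP, hP⟩ <;> rcases hW with ⟨hvW, hW⟩ | ⟨hvW, hW⟩
    · rw [← Finset.subset_insert_iff] at hP hW
      have hQ : IsCliqueIn ((v, p) :: l) (insert v p) :=
        Or.inl ⟨by simp, by rw [Finset.erase_insert h1]⟩
      rw [sampleExp_eq_localExp hy hl hQ ((ha.dependsOn.mono hP).comp₂ (hb.dependsOn.mono hW)
        fun u v => u * v + (1 - u) * (1 - v))]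
      exact ha.localExp_mul_le hy hg hg01 hg' hg'01 hb hP hW
        ((Finset.card_insert_le _ _).trans (by omega))
    · rw [← Finset.subset_insert_iff] at hP
      rw [sampleExp, resample_agreement hb.dependsOn hvW]
      exact ih (ha.step hy h1 h2 hvP hP) hb h4 h3 hW
    · rw [← Finset.subset_insert_iff] at hW
      have hswap : (fun z => a z * b z + (1 - a z) * (1 - b z)) =
          fun z => b z * a z + (1 - b z) * (1 - a z) := by
        funext z
        ring
      have := ih ha (hb.step hy h1 h2 hvW hW) h4 hP h3
      rw [sampleExp, hswap, resample_agreement ha.dependsOn hvP]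
      simpa only [mul_comm] using this
    · rw [sampleExp, resample_eq_self ((ha.dependsOn.mono Finset.subset_union_left).comp₂
        (hb.dependsOn.mono Finset.subset_union_right) fun u v => u * v + (1 - u) * (1 - v))
        (W := P ∪ W) (by simp [hvP, hvW])]
      exact ih ha hb h4 hP hW

end Pair

/-- The indicator of `v ∈ z`, as a function of `z`. -/
def memInd {V : Type*} [DecidableEq V] (v : V) (z : Finset V) : ℝ := if v ∈ z then 1 else 0

/-- The indicator of `z` separating `u` from `v`, as a function of `z`. -/
def cutInd {V : Type*} [DecidableEq V] (u v : V) (z : Finset V) : ℝ :=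
  memInd u z * (1 - memInd v z) + (1 - memInd u z) * memInd v z

section Cut

theorem memInd_eq_zero_or_one {V : Type*} [DecidableEq V] (v : V) (z : Finset V) :
    memInd v z = 0 ∨ memInd v z = 1 := by
  rw [memInd]
  split_ifs <;> simp

theorem memInd_dependsOnSet {V : Type*} [DecidableEq V] (v : V) : DependsOnSet (memInd v) {v} :=
  fun z => by simp [memInd]

theorem cutInd_dependsOnSet {V : Type*} [DecidableEq V] (u v : V) :
    DependsOnSet (cutInd u v) {u, v} :=
  ((memInd_dependsOnSet u).mono (by simp)).comp₂ ((memInd_dependsOnSet v).mono (by simp))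
    fun a b => a * (1 - b) + (1 - a) * b

theorem sum_cut_eq {V : Type*} [Fintype V] [DecidableEq V] {d : V → V → ℝ}
    (hd : ∀ u v, d u v = d v u) (S : Finset V) :
    ∑ u ∈ S, ∑ v ∈ Sᶜ, d u v = (1 / 2) * ∑ u, ∑ v, d u v * cutInd u v S := by
  have h1 : ∑ u ∈ S, ∑ v ∈ Sᶜ, d u v = ∑ u, ∑ v, d u v * (memInd u S * (1 - memInd v S)) := by
    rw [← Finset.univ_inter S, ← Finset.sum_ite_mem, Finset.univ_inter]
    refine Finset.sum_congr rfl fun u _ => ?_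
    rw [← Finset.univ_inter Sᶜ, ← Finset.sum_ite_mem]
    by_cases hu : u ∈ S
    · rw [if_pos hu]
      refine Finset.sum_congr rfl fun v _ => ?_
      by_cases hv : v ∈ S <;> simp [memInd, hu, hv]
    · simp [memInd, hu]
  have h2 : ∑ u, ∑ v, d u v * ((1 - memInd u S) * memInd v S) =
      ∑ u, ∑ v, d u v * (memInd u S * (1 - memInd v S)) := by
    rw [Finset.sum_comm]
    refine Finset.sum_congr rfl fun u _ => Finset.sum_congr rfl fun v _ => ?_
    rw [hd]
    ring
  simp only [cutInd, mul_add, Finset.sum_add_distrib] at h2 ⊢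
  rw [h2, h1]
  ring

variable {n r : ℕ} {y : Finset (Fin n) → ℝ}

theorem localExp_compl_mul_memInd {s t : Fin n} (hst : s ≠ t) :
    localExp y {s, t} (fun z => (1 - memInd s z) * memInd t z) = saIJ y {s} {t} := by
  have h1 : ({s, t} : Finset (Fin n)) \ {t} = {s} := by
    ext i
    simp only [Finset.mem_sdiff, Finset.mem_insert, Finset.mem_singleton]
    constructor
    · tauto
    · rintro rfl
      exact ⟨Or.inl rfl, hst⟩
  have hpow : ({t} : Finset (Fin n)).powerset = {∅, {t}} := by
    ext x
    simp [Finset.subset_singleton_iff]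
  rw [localExp, Finset.sum_powerset_insert (by simpa using hst), hpow,
    Finset.sum_pair (Finset.singleton_ne_empty t).symm,
    Finset.sum_pair (Finset.singleton_ne_empty t).symm]
  simp [memInd, h1, hst]

theorem localExp_cutInd {s t : Fin n} (hst : s ≠ t) :
    localExp y {s, t} (cutInd s t) = yNeq y s t := by
  have h : cutInd s t = fun z =>
      (1 - memInd s z) * memInd t z + (1 - memInd t z) * memInd s z := by
    funext z
    rw [cutInd]
    ring
  rw [h, localExp_add, localExp_compl_mul_memInd hst, Finset.pair_comm,
    localExp_compl_mul_memInd hst.symm, yNeq]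

theorem yNeq_le_sampleExp (hr : 0 < r) (hy : memSA (r + 3) y)
    {l : List (Fin n × Finset (Fin n))} (hl : IsElimination r l)
    (hsing : ∀ v, IsCliqueIn l {v}) {s t : Fin n} (hst : s ≠ t) :
    yNeq y s t ≤ 2 * (8 * flowConst (2 ^ r) + 4) * sampleExp y l (cutInd s t) := by
  have h : ∀ s t : Fin n, s ≠ t → saIJ y {s} {t} ≤
      (8 * flowConst (2 ^ r) + 4) * sampleExp y l (cutInd s t) := by
    intro s t hst
    have hs : DependsOnSet (fun z => 1 - memInd s z) {s} :=
      (memInd_dependsOnSet s).comp fun a => 1 - a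
    have hs01 : ∀ z, 1 - memInd s z = 0 ∨ 1 - memInd s z = 1 := fun z => by
      rcases memInd_eq_zero_or_one s z with h | h <;> simp [h]
    have hunit : ∀ a : ℝ, a = 0 ∨ a = 1 → 0 ≤ a ∧ a ≤ 1 := by
      rintro a (rfl | rfl) <;> norm_num
    have key := (IsCondChain.start (y := y) hr hs fun z => hunit _ (hs01 z)
      ).localExp_mul_le_sampleExp hy hs hs01 (memInd_dependsOnSet t)
      (memInd_eq_zero_or_one t) (IsCondChain.start (y := y) hr (memInd_dependsOnSet t)
        fun z => hunit _ (memInd_eq_zero_or_one t z)) hl (hsing s) (hsing t)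
    rw [localExp_compl_mul_memInd hst] at key
    convert key using 3
    funext z
    rw [cutInd]
    ring
  have hcomm : cutInd t s = cutInd s t := by
    funext z
    simp only [cutInd]
    ring
  have h1 := h s t hst
  have h2 := h t s hst.symm
  rw [hcomm] at h2
  rw [yNeq]
  linarith

/-- The averaging argument: a positive functional with `E δ > 0` has a point at which the ratio
`κ / δ` is at most `E κ / E δ`. -/
theorem exists_ratio_le (hy : memSA (r + 3) y) {l : List (Fin n × Finset (Fin n))}
    (hl : IsElimination r l) {κ δ : Finset (Fin n) → ℝ} (hκ : ∀ S, 0 ≤ κ S) (hδ : ∀ S, 0 ≤ δ S)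
    (hpos : 0 < sampleExp y l δ) :
    ∃ S, 0 < δ S ∧ κ S * sampleExp y l δ ≤ sampleExp y l κ * δ S := by
  by_contra! hS
  set e := sampleExp y l δ
  set c := sampleExp y l κ
  have hψ : ∀ S, 0 ≤ e * κ S + -c * δ S := fun S => by
    rcases (hδ S).eq_or_lt with h | h
    · rw [← h, mul_zero, add_zero]
      exact mul_nonneg hpos.le (hκ S)
    · linarith [hS S h]
  have hle : ∀ S, δ S ≤ (∑ S, δ S / (e * κ S + -c * δ S)) * (e * κ S + -c * δ S) := by
    intro S
    rcases (hδ S).eq_or_lt with h | h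
    · rw [← h]
      exact mul_nonneg (Finset.sum_nonneg fun S _ => div_nonneg (hδ S) (hψ S)) (h ▸ hψ S)
    · have hp : 0 < e * κ S + -c * δ S := by linarith [hS S h]
      rw [← div_le_iff₀ hp]
      exact Finset.single_le_sum (f := fun S => δ S / (e * κ S + -c * δ S))
        (fun S _ => div_nonneg (hδ S) (hψ S)) (Finset.mem_univ S)
  have h := sampleExp_mono hy hl hle
  rw [sampleExp_const_mul, sampleExp_add, sampleExp_const_mul, sampleExp_const_mul] at h
  have h0 : e * c + -c * e = 0 := by ring
  change e ≤ _ * (e * c + -c * e) at h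
  rw [h0, mul_zero] at h
  linarith

theorem sampleExp_sum_cut {d : Fin n → Fin n → ℝ} (hd : ∀ u v, d u v = d v u)
    (l : List (Fin n × Finset (Fin n))) :
    sampleExp y l (fun S => ∑ u ∈ S, ∑ v ∈ Sᶜ, d u v) =
      (1 / 2) * ∑ u, ∑ v, d u v * sampleExp y l (cutInd u v) := by
  simp_rw [sum_cut_eq hd, sampleExp_const_mul, sampleExp_sum, sampleExp_const_mul]

end Cut

/-- Theorem 1 of the paper, LP-rounding form: for every `r > 0` there is a
constant `C = C(r) > 0` such that for every graph `G` on `n` vertices with a tree decomposition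
of width at most `r`, every nonnegative symmetric capacities and demands, and every symmetric
vector `y ∈ SA_{r+3}(n)` normalized so that `∑_{(i,j)∈D} dem(i,j) y_{i≠j} = 1`, there is a cut
`S` crossing positive demand whose sparsity `Φ(S)` is at most `C` times the LP objective
`∑_{(i,j)∈E} cap(i,j) y_{i≠j}`.  (Sums over unordered pairs are written as half the sums over
ordered pairs; the cut capacity/demand sums over ordered pairs `S × Sᶜ` count each unordered
crossing pair exactly once.) -/
theorem stmt0 (r : ℕ) (hr : 0 < r) :
    ∃ C : ℝ, 0 < C ∧
      ∀ (n : ℕ) (G : SimpleGraph (Fin n)) (cap dem : Fin n → Fin n → ℝ)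
        (td : TreeDecomp G) (y : Finset (Fin n) → ℝ),
        1 ≤ n →
        (∀ i, (td.bags i).card ≤ r + 1) →
        (∀ u v, cap u v = cap v u) → (∀ u v, 0 ≤ cap u v) →
        (∀ u v, ¬ G.Adj u v → cap u v = 0) →
        (∀ u v, dem u v = dem v u) → (∀ u v, 0 ≤ dem u v) → (∀ u, dem u u = 0) →
        memSA (r + 3) y →
        (∀ I J : Finset (Fin n), (I ∪ J).card ≤ r + 3 → saIJ y I J = saIJ y J I) →
        (1 / 2) * (∑ u, ∑ v, dem u v * yNeq y u v) = 1 →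
        ∃ S : Finset (Fin n),
          0 < (∑ u ∈ S, ∑ v ∈ Sᶜ, dem u v) ∧
          (∑ u ∈ S, ∑ v ∈ Sᶜ, cap u v) ≤
            C * ((1 / 2) * ∑ u, ∑ v, cap u v * yNeq y u v) * (∑ u ∈ S, ∑ v ∈ Sᶜ, dem u v) := by
  have hF := flowConst_pos (2 ^ r)
  refine ⟨2 * (8 * flowConst (2 ^ r) + 4), by positivity, ?_⟩
  intro n G cap dem td y _ hcard hcap hcap0 hcapG hdem hdem0 hdemd hy _ hnorm
  obtain ⟨l, hl, hbags⟩ := exists_elimination td hcard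
  have hsing : ∀ v, IsCliqueIn l {v} := fun v => by
    obtain ⟨i, hi⟩ := td.covers_vertices v
    exact (hbags i).mono hl (by simpa using hi)
  have hEcap : sampleExp y l (fun S => ∑ u ∈ S, ∑ v ∈ Sᶜ, cap u v) =
      (1 / 2) * ∑ u, ∑ v, cap u v * yNeq y u v := by
    rw [sampleExp_sum_cut hcap]
    congr 1
    refine Finset.sum_congr rfl fun u _ => Finset.sum_congr rfl fun v _ => ?_
    by_cases huv : G.Adj u v
    · obtain ⟨i, hu, hv⟩ := td.covers_edges u v huv
      rw [sampleExp_eq_localExp hy hl ((hbags i).mono hl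
        (Finset.insert_subset hu (Finset.singleton_subset_iff.2 hv))) (cutInd_dependsOnSet u v),
        localExp_cutInd huv.ne]
    · rw [hcapG u v huv, zero_mul, zero_mul]
  have hEdem : 1 ≤ 2 * (8 * flowConst (2 ^ r) + 4) *
      sampleExp y l (fun S => ∑ u ∈ S, ∑ v ∈ Sᶜ, dem u v) := by
    rw [sampleExp_sum_cut hdem, mul_left_comm]
    refine hnorm.symm.le.trans (mul_le_mul_of_nonneg_left ?_ (by norm_num))
    simp_rw [Finset.mul_sum]
    refine Finset.sum_le_sum fun u _ => Finset.sum_le_sum fun v _ => ?_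
    rw [mul_left_comm]
    by_cases huv : u = v
    · rw [huv, hdemd, zero_mul, zero_mul]
    · exact mul_le_mul_of_nonneg_left (yNeq_le_sampleExp hr hy hl hsing huv) (hdem0 u v)
  have hepos : 0 < sampleExp y l (fun S => ∑ u ∈ S, ∑ v ∈ Sᶜ, dem u v) :=
    (pos_iff_pos_of_mul_pos (one_pos.trans_le hEdem)).1 (by positivity)
  have hcut0 : ∀ S : Finset (Fin n), 0 ≤ ∑ u ∈ S, ∑ v ∈ Sᶜ, cap u v := fun S =>
    Finset.sum_nonneg fun u _ => Finset.sum_nonneg fun v _ => hcap0 u v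
  obtain ⟨S, hS, hle⟩ := exists_ratio_le hy hl hcut0 (fun S =>
    Finset.sum_nonneg fun u _ => Finset.sum_nonneg fun v _ => hdem0 u v)
    hepos
  refine ⟨S, hS, ?_⟩
  rw [hEcap] at hle
  calc ∑ u ∈ S, ∑ v ∈ Sᶜ, cap u v
      ≤ (∑ u ∈ S, ∑ v ∈ Sᶜ, cap u v) * (2 * (8 * flowConst (2 ^ r) + 4) *
          sampleExp y l (fun S => ∑ u ∈ S, ∑ v ∈ Sᶜ, dem u v)) :=
        le_mul_of_one_le_right (hcut0 S) hEdem
    _ = 2 * (8 * flowConst (2 ^ r) + 4) * ((∑ u ∈ S, ∑ v ∈ Sᶜ, cap u v) *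
          sampleExp y l (fun S => ∑ u ∈ S, ∑ v ∈ Sᶜ, dem u v)) := by ring
    _ ≤ 2 * (8 * flowConst (2 ^ r) + 4) * ((1 / 2) * (∑ u, ∑ v, cap u v * yNeq y u v) *
          ∑ u ∈ S, ∑ v ∈ Sᶜ, dem u v) := mul_le_mul_of_nonneg_left hle (by positivity)
    _ = _ := by ring
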